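/- Modified Ekeland variational lemma: let F : [0,T]×𝒲 → ℝ be continuous and bounded from below. Then for every ε>0 there exists (t̄,μ̄) ∈ [0,T]×𝒲 such that F(t,μ) ≥ F(t̄,μ̄) − ε·d(μ,μ̄) for all (t,μ) ∈ [0,T]×𝒲, and F(t̄,μ̄) ≤ inf_{[0,T]×𝒲} F + ε. (Note that the penalization involves only the distance in the measure variable, not in time.) -/

import Mathlib

open MeasureTheory Set Filter
open scoped ENNReal NNReal

noncomputable section

/-- Euclidean state space `ℝ^n`. -/
abbrev Euc (n : ℕ) := EuclideanSpace ℝ (Fin n)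

/-- `π` is a coupling (transport plan) between `μ` and `ν`. -/
def IsCoupling {n : ℕ} (π : Measure (Euc n × Euc n)) (μ ν : Measure (Euc n)) : Prop :=
  π.map Prod.fst = μ ∧ π.map Prod.snd = ν

/-- Squared Wasserstein-2 distance. -/
def wSq {n : ℕ} (μ ν : Measure (Euc n)) : ℝ :=
  sInf { c | ∃ π : Measure (Euc n × Euc n), IsProbabilityMeasure π ∧ IsCoupling π μ ν ∧
      c = ∫ q, ‖q.1 - q.2‖ ^ 2 ∂π }

/-- Wasserstein-2 distance. -/
def wdist {n : ℕ} (μ ν : Measure (Euc n)) : ℝ := Real.sqrt (wSq μ ν)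

/-- The Wasserstein space 𝒲: Borel probability measures with finite second moment. -/
def W2 (n : ℕ) : Set (Measure (Euc n)) :=
  { μ | IsProbabilityMeasure μ ∧ (∫⁻ x, (‖x‖₊ : ℝ≥0∞) ^ 2 ∂μ) < ⊤ }

open ProbabilityTheory Topology

/-- **Ekeland's variational principle** for continuous functions on complete pseudometric spaces. -/
theorem exists_forall_sub_mul_dist_le {α : Type*} [PseudoMetricSpace α] [CompleteSpace α]
    {G : α → ℝ} (hG : Continuous G) (hb : BddBelow (range G)) {ε : ℝ} (hε : 0 < ε) (x₀ : α) :
    ∃ x, G x ≤ G x₀ ∧ ∀ y, G x - ε * dist y x ≤ G y := by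
  let S : α → Set α := fun x => {y | G y + ε * dist y x ≤ G x}
  have hself : ∀ x, x ∈ S x := fun x => by simp [S]
  have hbS : ∀ x, BddBelow (G '' S x) := fun x => hb.mono (image_subset_range _ _)
  have hstep : ∀ (k : ℕ) (x : α), ∃ y ∈ S x, G y < sInf (G '' S x) + (1 / 2 : ℝ) ^ k := by
    intro k x
    obtain ⟨_, ⟨y, hy, rfl⟩, hlt⟩ := exists_lt_of_csInf_lt (s := G '' S x)
      (b := sInf (G '' S x) + (1 / 2 : ℝ) ^ k) ⟨_, mem_image_of_mem G (hself x)⟩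
      (lt_add_of_pos_right _ (by positivity))
    exact ⟨y, hy, hlt⟩
  choose next hnextS hnextG using hstep
  let u : ℕ → α := fun k => Nat.rec x₀ (fun k x => next k x) k
  have hu : ∀ k, u (k + 1) = next k (u k) := fun _ => rfl
  have huS : ∀ k m, k ≤ m → u m ∈ S (u k) := by
    intro k m hkm
    induction m, hkm using Nat.le_induction with
    | base => exact hself _
    | succ m _ ih =>
      have h := hnextS m (u m)
      rw [← hu] at h
      simp only [S, mem_ofPred_eq] at h ih ⊢
      nlinarith [dist_triangle (u (m + 1)) (u m) (u k)]
  have hanti : Antitone (G ∘ u) := fun k m hkm => by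
    have h := huS k m hkm
    simp only [S, mem_ofPred_eq] at h
    have : 0 ≤ ε * dist (u m) (u k) := by positivity
    simp only [Function.comp_apply]
    linarith
  obtain ⟨l, hl⟩ : ∃ l, Tendsto (G ∘ u) atTop (𝓝 l) :=
    ⟨_, tendsto_atTop_ciInf hanti (hb.mono (range_comp_subset_range u G))⟩
  have hle : ∀ k, l ≤ G (u k) := fun k => hanti.le_of_tendsto hl k
  have hcau : CauchySeq u := by
    refine cauchySeq_of_le_tendsto_0' (fun k => (G (u k) - l) / ε) (fun k m hkm => ?_) ?_
    · have h := huS k m hkm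
      simp only [S, mem_ofPred_eq] at h
      rw [le_div_iff₀ hε, dist_comm]
      linarith [hle m]
    · simpa using (hl.sub_const l).div_const ε
  obtain ⟨x, hx⟩ := cauchySeq_tendsto_of_complete hcau
  have hGx : Tendsto (G ∘ u) atTop (𝓝 (G x)) := (hG.tendsto x).comp hx
  have hxS : ∀ k, x ∈ S (u k) := fun k =>
    le_of_tendsto (hGx.add ((hx.dist tendsto_const_nhds).const_mul ε))
      (eventually_atTop.2 ⟨k, fun m hm => huS k m hm⟩)
  refine ⟨x, hanti.le_of_tendsto hGx 0, fun y => ?_⟩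
  by_contra! hy
  have hyS : ∀ k, y ∈ S (u k) := by
    intro k
    have h := hxS k
    simp only [S, mem_ofPred_eq] at h ⊢
    nlinarith [dist_triangle y x (u k)]
  have hyG : G x ≤ G y := by
    refine le_of_tendsto_of_tendsto (hGx.comp (tendsto_add_atTop_nat 1))
      (b := atTop) (g := fun k : ℕ => G y + (1 / 2 : ℝ) ^ k) ?_ ?_
    · simpa using (tendsto_pow_atTop_nhds_zero_of_lt_one (by norm_num : (0 : ℝ) ≤ 1 / 2)
        (by norm_num)).const_add (G y)
    · refine Eventually.of_forall fun k => ?_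
      simp only [Function.comp_apply, hu]
      linarith [hnextG k (u k), csInf_le (hbS (u k)) (mem_image_of_mem G (hyS k))]
  have : 0 ≤ ε * dist y x := by positivity
  linarith

theorem map_prodMap_compProd_comap {α β γ : Type*} [MeasurableSpace α] [MeasurableSpace β]
    [MeasurableSpace γ] (μ : Measure α) [SFinite μ] (κ : Kernel β γ) [IsSFiniteKernel κ]
    {f : α → β} (hf : Measurable f) :
    (μ ⊗ₘ κ.comap f hf).map (Prod.map f id) = μ.map f ⊗ₘ κ := by
  have hm : Measurable (Prod.map f (id : γ → γ)) := hf.prodMap measurable_id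
  ext s hs
  rw [Measure.map_apply hm hs, Measure.compProd_apply (hm hs), Measure.compProd_apply hs,
    lintegral_map (Kernel.measurable_kernel_prodMk_left hs) hf]
  rfl

/-- Gluing lemma: couplings whose consecutive marginals agree are the laws of consecutive pairs
of a single random sequence. -/
theorem exists_measure_forall_map_pair_eq {E : Type*} [MeasurableSpace E] [StandardBorelSpace E]
    [Nonempty E] (π : ℕ → Measure (E × E)) [∀ k, IsProbabilityMeasure (π k)]
    (h : ∀ k, (π k).snd = (π (k + 1)).fst) :
    ∃ P : Measure (ℕ → E), IsProbabilityMeasure P ∧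
      ∀ k, P.map (fun x => (x k, x (k + 1))) = π k := by
  let κ : (k : ℕ) → Kernel ((i : Finset.Iic k) → E) E := fun k =>
    (π k).condKernel.comap (fun x => x ⟨k, Finset.mem_Iic.2 le_rfl⟩) (measurable_pi_apply _)
  let P : Measure (ℕ → E) := Kernel.trajMeasure (X := fun _ => E) (π 0).fst κ
  have hpair : ∀ k, P.map (fun x => (x k, x (k + 1))) =
      P.map (fun x => x k) ⊗ₘ (π k).condKernel := by
    intro k
    have h1 : P.map (Preorder.frestrictLe k) ⊗ₘ κ k =
        P.map (fun x => (Preorder.frestrictLe k x, x (k + 1))) :=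
      Kernel.map_frestrictLe_trajMeasure_compProd_eq_map_trajMeasure
    have h2 := congrArg (fun ρ => ρ.map
      (Prod.map (fun x : (i : Finset.Iic k) → E => x ⟨k, Finset.mem_Iic.2 le_rfl⟩) id)) h1
    simp only [κ] at h2
    rw [map_prodMap_compProd_comap, Measure.map_map (by fun_prop) (by fun_prop),
      Measure.map_map (by fun_prop) (by fun_prop)] at h2
    exact h2.symm
  have hzero : P.map (fun x => x 0) = (π 0).fst := by
    have h1 : P.map (Preorder.frestrictLe 0) =
        (π 0).fst.map (MeasurableEquiv.piUnique (fun _ : Finset.Iic 0 => E)).symm := by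
      simp only [P, Kernel.trajMeasure]
      rw [Measure.map_comp _ _ (by fun_prop), Kernel.traj_map_frestrictLe,
        Kernel.partialTraj_self, Measure.id_comp]
    have h2 := congrArg (fun ρ => ρ.map (MeasurableEquiv.piUnique (fun _ : Finset.Iic 0 => E))) h1
    simp only [MeasurableEquiv.map_map_symm] at h2
    rw [Measure.map_map (by fun_prop) (by fun_prop)] at h2
    exact h2
  have hmarg : ∀ k, P.map (fun x => x k) = (π k).fst := by
    intro k
    induction k with
    | zero => exact hzero
    | succ k ih =>
      have h1 := hpair k
      rw [ih, Measure.disintegrate] at h1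
      rw [← h, ← h1, Measure.snd, Measure.map_map (by fun_prop) (by fun_prop)]
      rfl
  exact ⟨P, inferInstance, fun k => by rw [hpair, hmarg, Measure.disintegrate]⟩

theorem memLp_id_of_mem_W2 {n : ℕ} {μ : Measure (Euc n)} (hμ : μ ∈ W2 n) : MemLp id 2 μ := by
  refine ⟨aestronglyMeasurable_id, (eLpNorm_lt_top_iff_lintegral_rpow_enorm_lt_top
    (by norm_num) (by norm_num)).2 ?_⟩
  simpa [enorm_eq_nnnorm] using hμ.2

theorem map_mem_W2 {n : ℕ} {Ω : Type*} [MeasurableSpace Ω] {P : Measure Ω}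
    [IsProbabilityMeasure P] {X : Ω → Euc n} (hX : MemLp X 2 P) : P.map X ∈ W2 n := by
  have hm : AEMeasurable X P := hX.1.aemeasurable
  refine ⟨Measure.isProbabilityMeasure_map hm, ?_⟩
  have h := (eLpNorm_lt_top_iff_lintegral_rpow_enorm_lt_top
    (by norm_num) (by norm_num)).1 hX.2
  rw [lintegral_map' (by fun_prop) hm]
  simpa [enorm_eq_nnnorm] using h

theorem eLpNorm_two_eq_ofReal_sqrt {n : ℕ} {Ω : Type*} [MeasurableSpace Ω] {P : Measure Ω}
    {X : Ω → Euc n} (hX : MemLp X 2 P) :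
    eLpNorm X 2 P = ENNReal.ofReal (√(∫ ω, ‖X ω‖ ^ 2 ∂P)) := by
  rw [hX.eLpNorm_eq_integral_rpow_norm (by norm_num) (by norm_num), Real.sqrt_eq_rpow]
  norm_num

theorem bddBelow_couplingCosts {n : ℕ} (μ ν : Measure (Euc n)) :
    BddBelow { c : ℝ | ∃ π : Measure (Euc n × Euc n), IsProbabilityMeasure π ∧
      IsCoupling π μ ν ∧ c = ∫ q, ‖q.1 - q.2‖ ^ 2 ∂π } :=
  ⟨0, by rintro _ ⟨π, _, _, rfl⟩; exact integral_nonneg fun q => by positivity⟩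

theorem wSq_nonneg {n : ℕ} (μ ν : Measure (Euc n)) : 0 ≤ wSq μ ν :=
  Real.sInf_nonneg (by rintro _ ⟨π, _, _, rfl⟩; exact integral_nonneg fun q => by positivity)

theorem ofReal_wdist_map_le {n : ℕ} {Ω : Type*} [MeasurableSpace Ω] {P : Measure Ω}
    [IsProbabilityMeasure P] {X Y : Ω → Euc n} (hX : MemLp X 2 P) (hY : MemLp Y 2 P) :
    ENNReal.ofReal (wdist (P.map X) (P.map Y)) ≤ eLpNorm (X - Y) 2 P := by
  have hXm : AEMeasurable X P := hX.1.aemeasurable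
  have hYm : AEMeasurable Y P := hY.1.aemeasurable
  rw [eLpNorm_two_eq_ofReal_sqrt (hX.sub hY)]
  refine ENNReal.ofReal_le_ofReal (Real.sqrt_le_sqrt (csInf_le (bddBelow_couplingCosts _ _)
    ⟨P.map fun ω => (X ω, Y ω), Measure.isProbabilityMeasure_map (hXm.prodMk hYm), ⟨?_, ?_⟩, ?_⟩))
  · rw [AEMeasurable.map_map_of_aemeasurable (by fun_prop) (hXm.prodMk hYm)]
    rfl
  · rw [AEMeasurable.map_map_of_aemeasurable (by fun_prop) (hXm.prodMk hYm)]
    rfl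
  · rw [integral_map (hXm.prodMk hYm) (by fun_prop)]
    rfl

theorem exists_coupling_eLpNorm_sub_lt {n : ℕ} {μ ν : Measure (Euc n)} (hμ : μ ∈ W2 n)
    (hν : ν ∈ W2 n) {c : ℝ} (hc : wdist μ ν < c) :
    ∃ π : Measure (Euc n × Euc n), IsProbabilityMeasure π ∧ π.fst = μ ∧ π.snd = ν ∧
      eLpNorm (fun q => q.1 - q.2) 2 π < ENNReal.ofReal c := by
  have := hμ.1
  have := hν.1
  have hc0 : 0 < c := (Real.sqrt_nonneg _).trans_lt hc
  have hlt : wSq μ ν < c ^ 2 := (Real.sqrt_lt' hc0).1 hc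
  obtain ⟨_, ⟨π, hπ, ⟨h1, h2⟩, rfl⟩, hπc⟩ := exists_lt_of_csInf_lt
    (s := { c : ℝ | ∃ π : Measure (Euc n × Euc n), IsProbabilityMeasure π ∧
      IsCoupling π μ ν ∧ c = ∫ q, ‖q.1 - q.2‖ ^ 2 ∂π })
    ⟨_, μ.prod ν, inferInstance, ⟨by simp, by simp⟩, rfl⟩ hlt
  refine ⟨π, hπ, h1, h2, ?_⟩
  have hfst : MemLp (fun q : Euc n × Euc n => q.1) 2 π :=
    (h1 ▸ memLp_id_of_mem_W2 hμ : MemLp id 2 (π.map Prod.fst)).comp_of_map (by fun_prop)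
  have hsnd : MemLp (fun q : Euc n × Euc n => q.2) 2 π :=
    (h2 ▸ memLp_id_of_mem_W2 hν : MemLp id 2 (π.map Prod.snd)).comp_of_map (by fun_prop)
  have hsub : MemLp (fun q : Euc n × Euc n => q.1 - q.2) 2 π := hfst.sub hsnd
  rw [eLpNorm_two_eq_ofReal_sqrt hsub, ENNReal.ofReal_lt_ofReal_iff hc0]
  exact (Real.sqrt_lt' hc0).2 hπc

theorem wdist_self {n : ℕ} {μ : Measure (Euc n)} (hμ : μ ∈ W2 n) : wdist μ μ = 0 := by
  have := hμ.1
  have h := ofReal_wdist_map_le (memLp_id_of_mem_W2 hμ) (memLp_id_of_mem_W2 hμ)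
  rw [sub_self, eLpNorm_zero, Measure.map_id, nonpos_iff_eq_zero, ENNReal.ofReal_eq_zero] at h
  exact h.antisymm (Real.sqrt_nonneg _)

theorem wdist_comm {n : ℕ} (μ ν : Measure (Euc n)) : wdist μ ν = wdist ν μ := by
  have key : ∀ μ ν : Measure (Euc n), { c : ℝ | ∃ π : Measure (Euc n × Euc n),
      IsProbabilityMeasure π ∧ IsCoupling π μ ν ∧ c = ∫ q, ‖q.1 - q.2‖ ^ 2 ∂π } ⊆
      { c : ℝ | ∃ π : Measure (Euc n × Euc n), IsProbabilityMeasure π ∧ IsCoupling π ν μ ∧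
        c = ∫ q, ‖q.1 - q.2‖ ^ 2 ∂π } := by
    rintro μ ν _ ⟨π, _, ⟨h1, h2⟩, rfl⟩
    refine ⟨π.map Prod.swap, Measure.isProbabilityMeasure_map (by fun_prop), ⟨?_, ?_⟩, ?_⟩
    · rw [Measure.map_map (by fun_prop) (by fun_prop)]
      exact h2
    · rw [Measure.map_map (by fun_prop) (by fun_prop)]
      exact h1
    · rw [integral_map (by fun_prop) (by fun_prop)]
      simp only [Prod.fst_swap, Prod.snd_swap, norm_sub_rev]
  exact congrArg (fun s => √(sInf s)) ((key μ ν).antisymm (key ν μ))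

/-- Realisation of a sequence in Wasserstein space, with prescribed bounds on consecutive
distances, by square-integrable random variables on a single probability space. -/
theorem exists_realization {n : ℕ} {u : ℕ → Measure (Euc n)} (hu : ∀ k, u k ∈ W2 n) {c : ℕ → ℝ}
    (hc : ∀ k, wdist (u k) (u (k + 1)) < c k) :
    ∃ P : Measure (ℕ → Euc n), IsProbabilityMeasure P ∧ (∀ k, P.map (fun x => x k) = u k) ∧
      (∀ k, MemLp (fun x : ℕ → Euc n => x k) 2 P) ∧
      ∀ k, eLpNorm ((fun x : ℕ → Euc n => x k) - fun x => x (k + 1)) 2 P < ENNReal.ofReal (c k) := by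
  choose π hπ h1 h2 hlt using fun k => exists_coupling_eLpNorm_sub_lt (hu k) (hu (k + 1)) (hc k)
  obtain ⟨P, hP, hpair⟩ := exists_measure_forall_map_pair_eq π fun k => by rw [h1, h2]
  have hmap : ∀ k, P.map (fun x => x k) = u k := fun k => by
    rw [← h1 k, ← hpair k, Measure.fst, Measure.map_map (by fun_prop) (by fun_prop)]
    rfl
  refine ⟨P, hP, hmap, fun k => ?_, fun k => ?_⟩
  · exact ((hmap k).symm ▸ memLp_id_of_mem_W2 (hu k) :
      MemLp id 2 (P.map fun x => x k)).comp_of_map (measurable_pi_apply k).aemeasurable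
  · have h := hlt k
    rw [← hpair k, eLpNorm_map_measure (by fun_prop) (by fun_prop)] at h
    exact h

theorem wdist_triangle {n : ℕ} {μ ν ρ : Measure (Euc n)} (hμ : μ ∈ W2 n) (hν : ν ∈ W2 n)
    (hρ : ρ ∈ W2 n) : wdist μ ρ ≤ wdist μ ν + wdist ν ρ := by
  refine le_of_forall_pos_lt_add fun δ hδ => ?_
  let u : ℕ → Measure (Euc n) := fun k => if k = 0 then μ else if k = 1 then ν else ρ
  have hu : ∀ k, u k ∈ W2 n := fun k => by
    simp only [u]
    split_ifs <;> assumption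
  obtain ⟨P, _, hmap, hLp, hlt⟩ := exists_realization hu
    (c := fun k => wdist (u k) (u (k + 1)) + δ / 2) fun k => by linarith
  have h0 : 0 ≤ wdist μ ν := Real.sqrt_nonneg _
  have h1 : 0 ≤ wdist ν ρ := Real.sqrt_nonneg _
  have h := calc
    ENNReal.ofReal (wdist μ ρ)
      ≤ eLpNorm ((fun x : ℕ → Euc n => x 0) - fun x => x 2) 2 P := by
        have h02 := ofReal_wdist_map_le (hLp 0) (hLp 2)
        rwa [hmap, hmap] at h02
    _ = eLpNorm (((fun x : ℕ → Euc n => x 0) - fun x => x 1) +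
          ((fun x : ℕ → Euc n => x 1) - fun x => x 2)) 2 P := by rw [sub_add_sub_cancel]
    _ ≤ _ := eLpNorm_add_le ((hLp 0).1.sub (hLp 1).1) ((hLp 1).1.sub (hLp 2).1) (by norm_num)
    _ < ENNReal.ofReal (wdist μ ν + δ / 2) + ENNReal.ofReal (wdist ν ρ + δ / 2) :=
        ENNReal.add_lt_add (hlt 0) (hlt 1)
    _ = ENNReal.ofReal (wdist μ ν + wdist ν ρ + δ) := by
        rw [← ENNReal.ofReal_add (by positivity) (by positivity)]
        ring_nf
  exact (ENNReal.ofReal_lt_ofReal_iff (by positivity)).1 h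

instance W2.instPseudoMetricSpace (n : ℕ) : PseudoMetricSpace (W2 n) where
  dist μ ν := wdist (μ : Measure (Euc n)) ν
  dist_self μ := wdist_self μ.2
  dist_comm μ ν := wdist_comm _ _
  dist_triangle μ ν ρ := wdist_triangle μ.2 ν.2 ρ.2

instance W2.instCompleteSpace (n : ℕ) : CompleteSpace (W2 n) := by
  refine Metric.complete_of_convergent_controlled_sequences (fun k => (1 / 2 : ℝ) ^ k)
    (fun k => by positivity) fun u hu => ?_
  obtain ⟨P, _, hmap, hLp, hlt⟩ := exists_realization (fun k => (u k).2)
    (c := fun k => (1 / 2 : ℝ) ^ k) fun k => hu k k (k + 1) le_rfl (Nat.le_succ k)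
  let X : ℕ → Lp (Euc n) 2 P := fun k => (hLp k).toLp _
  have hcau : CauchySeq X := by
    refine cauchySeq_of_le_geometric (1 / 2) 1 (by norm_num) fun k => ?_
    rw [dist_edist, Lp.edist_toLp_toLp, one_mul]
    exact ENNReal.toReal_le_of_le_ofReal (by positivity) (hlt k).le
  obtain ⟨Y, hY⟩ := cauchySeq_tendsto_of_complete hcau
  refine ⟨⟨P.map Y, map_mem_W2 (Lp.memLp Y)⟩, tendsto_iff_dist_tendsto_zero.2
    (squeeze_zero (fun _ => dist_nonneg) (fun k => ?_) (tendsto_iff_dist_tendsto_zero.1 hY))⟩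
  have h := ofReal_wdist_map_le (Lp.memLp (X k)) (Lp.memLp Y)
  rw [Measure.map_congr (MemLp.coeFn_toLp (hLp k)), hmap, ← Lp.edist_def, edist_dist] at h
  exact (ENNReal.ofReal_le_ofReal_iff dist_nonneg).1 h

/-- modified Ekeland variational lemma: if `F : [0,T] × 𝒲 → ℝ` is
continuous and bounded from below, then for every `ε > 0` there is `(t̄,μ̄)` such that
`F(t,μ) ≥ F(t̄,μ̄) - ε·d(μ,μ̄)` for all `(t,μ) ∈ [0,T] × 𝒲`, and
`F(t̄,μ̄) ≤ inf F + ε`. -/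
theorem ekeland_variational_lemma (n : ℕ) (T : ℝ) (hT : 0 < T)
    (F : ℝ → Measure (Euc n) → ℝ)
    (hFcont : ∀ ε > 0, ∀ t ∈ Icc (0 : ℝ) T, ∀ μ ∈ W2 n, ∃ δ > 0,
        ∀ s ∈ Icc (0 : ℝ) T, ∀ ν ∈ W2 n, |t - s| + wdist μ ν < δ → |F t μ - F s ν| < ε)
    (hFbdd : ∃ m : ℝ, ∀ t ∈ Icc (0 : ℝ) T, ∀ μ ∈ W2 n, m ≤ F t μ)
    (ε : ℝ) (hε : 0 < ε) :
    ∃ tb ∈ Icc (0 : ℝ) T, ∃ μb ∈ W2 n,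
      (∀ t ∈ Icc (0 : ℝ) T, ∀ μ ∈ W2 n, F t μ ≥ F tb μb - ε * wdist μ μb) ∧
      F tb μb ≤ sInf { r | ∃ t ∈ Icc (0 : ℝ) T, ∃ μ ∈ W2 n, r = F t μ } + ε := by
  have hIcc : IsCompact (univ : Set (Icc (0 : ℝ) T)) := isCompact_univ
  let f : W2 n → Icc (0 : ℝ) T → ℝ := fun μ t => F t μ
  have hf : Continuous ↿f := by
    refine Metric.continuous_iff.2 fun ⟨μ, t⟩ δ hδ => ?_
    obtain ⟨η, hη, h⟩ := hFcont δ hδ t t.2 μ μ.2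
    refine ⟨η / 2, by positivity, fun ⟨ν, s⟩ hνs => ?_⟩
    obtain ⟨h1, h2⟩ := max_lt_iff.1 (Prod.dist_eq.symm.trans_lt hνs)
    rw [dist_comm] at h1 h2 ⊢
    refine h s s.2 ν ν.2 ?_
    have h3 : |(t : ℝ) - s| < η / 2 := h2
    have h4 : wdist (μ : Measure (Euc n)) ν < η / 2 := h1
    linarith
  let G : W2 n → ℝ := fun μ => sInf (f μ '' univ)
  have hG : Continuous G := hIcc.continuous_sInf hf
  obtain ⟨m, hm⟩ := hFbdd
  have hne : (univ : Set (Icc (0 : ℝ) T)).Nonempty := ⟨⟨0, le_rfl, hT.le⟩, mem_univ _⟩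
  have hmin : ∀ μ, ∃ t, G μ = f μ t ∧ ∀ s, f μ t ≤ f μ s := fun μ => by
    have hfμ : Continuous (f μ) := hf.comp (Continuous.prodMk_right μ)
    obtain ⟨t, -, ht, hts⟩ := hIcc.exists_sInf_image_eq_and_le hne hfμ.continuousOn
    exact ⟨t, ht, fun s => hts s (mem_univ s)⟩
  have hGb : BddBelow (range G) := by
    refine ⟨m, ?_⟩
    rintro _ ⟨μ, rfl⟩
    obtain ⟨t, ht, -⟩ := hmin μ
    exact ht ▸ hm t t.2 μ μ.2
  have hdirac : (Measure.dirac 0 : Measure (Euc n)) ∈ W2 n := ⟨inferInstance, by simp⟩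
  obtain ⟨_, ⟨t₀, ht₀, μ₀, hμ₀, rfl⟩, hlt⟩ := exists_lt_of_csInf_lt
    (s := { r | ∃ t ∈ Icc (0 : ℝ) T, ∃ μ ∈ W2 n, r = F t μ })
    ⟨_, 0, ⟨le_rfl, hT.le⟩, _, hdirac, rfl⟩ (lt_add_of_pos_right _ hε)
  obtain ⟨μb, hμb, hek⟩ := exists_forall_sub_mul_dist_le hG hGb hε ⟨μ₀, hμ₀⟩
  obtain ⟨tb, htb, -⟩ := hmin μb
  have hGle : ∀ (μ : W2 n) t, G μ ≤ f μ t := fun μ t => by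
    obtain ⟨s, hs, hst⟩ := hmin μ
    exact hs ▸ hst t
  refine ⟨tb, tb.2, μb, μb.2, fun t ht μ hμ => ?_, ?_⟩
  · exact (htb ▸ hek ⟨μ, hμ⟩ : f μb tb - _ ≤ _).trans (hGle ⟨μ, hμ⟩ ⟨t, ht⟩)
  · exact (htb ▸ hμb.trans (hGle _ ⟨t₀, ht₀⟩) : f μb tb ≤ _).trans hlt.le

end
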